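/- Let $d$ be a positive integer and $S_1^{(d)}$ the $T$-space of $k_0\langle X\rangle$ generated by $S^{(d)}(x_1,\ldots,x_d)$. For any $u, v \in k_0\langle X\rangle$: (i) $(S_1^{(d)} u v)^S \subseteq S_1^{(d)} + (S_1^{(d)} u)^S + (S_1^{(d)} v)^S$, and (ii) $(u v\, S_1^{(d)})^S \subseteq S_1^{(d)} + (u\, S_1^{(d)})^S + (v\, S_1^{(d)})^S$. -/

import Mathlib

open scoped BigOperators

/-- The free non-unital associative algebra over `k` on countably many variables,
realized as the semigroup algebra of the free semigroup on `ℕ`. -/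
abbrev FA (k : Type*) [Field k] := MonoidAlgebra k (FreeSemigroup ℕ)

/-- The generator (variable) `x_i`. -/
noncomputable def Xg (k : Type*) [Field k] (i : ℕ) : FA k :=
  MonoidAlgebra.single (FreeSemigroup.of i) 1

/-- Product of a (nonempty) list in a non-unital semiring; `0` on the empty list. -/
def lprod {A : Type*} [NonUnitalSemiring A] : List A → A
  | [] => 0
  | [a] => a
  | a :: b :: l => a * lprod (b :: l)

/-- `n`-th power in a non-unital semiring (zero for `n = 0`). -/
def npow' {A : Type*} [NonUnitalSemiring A] (a : A) (n : ℕ) : A :=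
  lprod (List.replicate n a)

/-- The full multilinear symmetrization `S^{(d)}(y_1,…,y_d) = ∑_{σ ∈ Σ_d} y_{σ(1)} ⋯ y_{σ(d)}`. -/
def Ssym {A : Type*} [NonUnitalSemiring A] (d : ℕ) (y : Fin d → A) : A :=
  ∑ σ : Equiv.Perm (Fin d), lprod (List.ofFn (fun i => y (σ i)))

/-- A T-space: a subspace closed under all substitution endomorphisms
(non-unital algebra endomorphisms). -/
def IsTSpace (k : Type*) [Field k] (V : Submodule k (FA k)) : Prop :=
  ∀ (φ : FA k →ₙₐ[k] FA k), ∀ v ∈ V, φ v ∈ V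

/-- The T-space generated by a set `S`: the span of all substitution instances
of elements of `S`. -/
noncomputable def TSpan (k : Type*) [Field k] (S : Set (FA k)) : Submodule k (FA k) :=
  Submodule.span k {a | ∃ (φ : FA k →ₙₐ[k] FA k) (s : FA k), s ∈ S ∧ a = φ s}

/-- The set of products `u * v` with `u ∈ U`, `v ∈ V`. -/
def mulSet {k : Type*} [Field k] (U V : Submodule k (FA k)) : Set (FA k) :=
  {a | ∃ u ∈ U, ∃ v ∈ V, a = u * v}

/-- The T-spaces `S_n^{(d)}`: `S_1^{(d)}` is generated by `S^{(d)}(x_1,…,x_d)` and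
`S_{n+1}^{(d)} = (S_n^{(d)} S_1^{(d)})^S`. -/
noncomputable def Sn (k : Type*) [Field k] (d : ℕ) : ℕ → Submodule k (FA k)
  | 0 => ⊥
  | 1 => TSpan k {Ssym d (fun i => Xg k i)}
  | (n+2) => TSpan k (mulSet (Sn k d (n+1)) (Sn k d 1))

/-- The T-spaces `H_n`: `H_1` is generated by `x_1^p` and `H_{n+1} = (H_n H_1)^S`. -/
noncomputable def Hn (k : Type*) [Field k] (p : ℕ) : ℕ → Submodule k (FA k)
  | 0 => ⊥
  | 1 => TSpan k {npow' (Xg k 0) p}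
  | (n+2) => TSpan k (mulSet (Hn k p (n+1)) (Hn k p 1))

/-- The word `x_1^p x_2^p ⋯ x_n^p`. -/
noncomputable def hword (k : Type*) [Field k] (p n : ℕ) : FA k :=
  lprod ((List.range n).map (fun t => npow' (Xg k t) p))

section Symmetrization

variable {A : Type*} [NonUnitalSemiring A]

theorem lprod_cons (a : A) {l : List A} (hl : l ≠ []) : lprod (a :: l) = a * lprod l := by
  cases l with
  | nil => exact absurd rfl hl
  | cons b l => rfl

theorem lprod_cons_cons (a b : A) (l : List A) : lprod (a :: b :: l) = lprod ((a * b) :: l) := by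
  cases l with
  | nil => rfl
  | cons c l => simp only [lprod, mul_assoc]

theorem lprod_append_singleton {l : List A} (hl : l ≠ []) (b : A) :
    lprod (l ++ [b]) = lprod l * b := by
  induction l with
  | nil => exact absurd rfl hl
  | cons a l ih =>
    cases l with
    | nil => rfl
    | cons c l =>
      rw [List.cons_append, lprod_cons a (by simp), ih (by simp), lprod_cons a (by simp), mul_assoc]

theorem lprod_ofFn_insertNth_succ {n : ℕ} (i : Fin n) (b : A) (c : Fin n → A) :
    lprod (List.ofFn (i.succ.insertNth b c : Fin (n + 1) → A)) =
      lprod (List.ofFn (Function.update c i (c i * b))) := by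
  induction n with
  | zero => exact i.elim0
  | succ n ih =>
    induction c using Fin.consCases with | _ a c => ?_
    refine Fin.cases ?_ (fun j => ?_) i
    · have h : ((0 : Fin (n + 1)).succ.insertNth b (Fin.cons a c : Fin (n + 1) → A) :
          Fin (n + 2) → A) = Fin.cons a (Fin.cons b c) := by
        rw [Fin.insertNth_eq_iff]
        refine ⟨rfl, funext fun j => ?_⟩
        refine Fin.cases ?_ (fun j => ?_) j <;> simp [Fin.removeNth]
      rw [h, Fin.cons_zero, Fin.update_cons_zero, List.ofFn_cons, List.ofFn_cons, List.ofFn_cons,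
        lprod_cons_cons]
    · obtain ⟨m, rfl⟩ : ∃ m, n = m + 1 := ⟨n - 1, by have := j.pos; omega⟩
      have h : (j.succ.succ.insertNth b (Fin.cons a c : Fin (m + 2) → A) :
          Fin (m + 3) → A) = Fin.cons a (j.succ.insertNth b c : Fin (m + 2) → A) := by
        rw [Fin.insertNth_eq_iff]
        refine ⟨by simp, funext fun j' => ?_⟩
        refine Fin.cases ?_ (fun j' => ?_) j' <;> simp [Fin.removeNth]
      rw [h, Fin.cons_succ, ← Fin.cons_update, List.ofFn_cons, List.ofFn_cons,
        lprod_cons _ (by simp), lprod_cons _ (by simp), ih]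

theorem lprod_ofFn_insertNth_castSucc {n : ℕ} (i : Fin n) (b : A) (c : Fin n → A) :
    lprod (List.ofFn (i.castSucc.insertNth b c : Fin (n + 1) → A)) =
      lprod (List.ofFn (Function.update c i (b * c i))) := by
  induction n with
  | zero => exact i.elim0
  | succ n ih =>
    induction c using Fin.consCases with | _ a c => ?_
    refine Fin.cases ?_ (fun j => ?_) i
    · rw [Fin.castSucc_zero, Fin.insertNth_zero', Fin.cons_zero, Fin.update_cons_zero,
        List.ofFn_cons, List.ofFn_cons, List.ofFn_cons, lprod_cons_cons]
    · obtain ⟨m, rfl⟩ : ∃ m, n = m + 1 := ⟨n - 1, by have := j.pos; omega⟩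
      have h : (j.succ.castSucc.insertNth b (Fin.cons a c : Fin (m + 2) → A) :
          Fin (m + 3) → A) = Fin.cons a (j.castSucc.insertNth b c : Fin (m + 2) → A) := by
        rw [← Fin.succ_castSucc, Fin.insertNth_eq_iff]
        refine ⟨by simp, funext fun j' => ?_⟩
        refine Fin.cases ?_ (fun j' => ?_) j' <;> simp [Fin.removeNth]
      rw [h, Fin.cons_succ, ← Fin.cons_update, List.ofFn_cons, List.ofFn_cons,
        lprod_cons _ (by simp), lprod_cons _ (by simp), ih]

/-- The permutation of `Fin (n + 1)` sending `p` to `0` and acting as `τ` on the other indices. -/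
def permInsert {n : ℕ} (p : Fin (n + 1)) (τ : Equiv.Perm (Fin n)) : Equiv.Perm (Fin (n + 1)) :=
  ((finSuccEquiv' p).trans τ.optionCongr).trans (finSuccEquiv' 0).symm

theorem permInsert_self {n : ℕ} (p : Fin (n + 1)) (τ : Equiv.Perm (Fin n)) :
    permInsert p τ p = 0 := by
  simp [permInsert]

theorem permInsert_succAbove {n : ℕ} (p : Fin (n + 1)) (τ : Equiv.Perm (Fin n)) (i : Fin n) :
    permInsert p τ (p.succAbove i) = (τ i).succ := by
  simp [permInsert]

theorem permInsert_bijective (n : ℕ) :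
    Function.Bijective fun q : Fin (n + 1) × Equiv.Perm (Fin n) => permInsert q.1 q.2 := by
  rw [Fintype.bijective_iff_injective_and_card]
  refine ⟨?_, by simp [Fintype.card_perm, Nat.factorial_succ]⟩
  rintro ⟨p, τ⟩ ⟨p', τ'⟩ h
  simp only at h
  obtain rfl : p = p' := by
    apply (permInsert p' τ').injective
    rw [← h, permInsert_self, h, permInsert_self]
  refine Prod.ext rfl (Equiv.ext fun i => ?_)
  have := permInsert_succAbove p τ i
  rw [h, permInsert_succAbove] at this
  exact (Fin.succ_injective _ this).symm

theorem Ssym_cons {n : ℕ} (b : A) (a : Fin n → A) :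
    Ssym (n + 1) (Fin.cons b a : Fin (n + 1) → A) =
      ∑ τ : Equiv.Perm (Fin n), ∑ p : Fin (n + 1),
        lprod (List.ofFn (p.insertNth b (fun i => a (τ i)) : Fin (n + 1) → A)) := by
  rw [Ssym, ← (permInsert_bijective n).sum_comp, Fintype.sum_prod_type_right]
  refine Finset.sum_congr rfl fun τ _ => Finset.sum_congr rfl fun p _ => ?_
  congr 2
  symm
  rw [Fin.insertNth_eq_iff]
  refine ⟨by simp [permInsert_self], funext fun i => ?_⟩
  simp [Fin.removeNth, permInsert_succAbove]

theorem sum_lprod_update {n : ℕ} (a : Fin n → A) (g : A → A) :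
    ∑ τ : Equiv.Perm (Fin n), ∑ i : Fin n,
        lprod (List.ofFn (Function.update (fun j => a (τ j)) i (g (a (τ i))))) =
      ∑ i : Fin n, Ssym n (Function.update a i (g (a i))) := by
  simp only [Ssym]
  conv_rhs => rw [Finset.sum_comm]
  refine Finset.sum_congr rfl fun τ _ => ?_
  conv_rhs => rw [← Equiv.sum_comp τ]
  refine Finset.sum_congr rfl fun i _ => ?_
  congr 2
  ext j
  simp only [Function.update_apply, τ.injective.eq_iff]

/-- Placing `b` either in front of, or directly after, one of the factors. -/
theorem Ssym_cons_left {n : ℕ} (hn : 1 ≤ n) (b : A) (a : Fin n → A) :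
    Ssym (n + 1) (Fin.cons b a : Fin (n + 1) → A) =
      b * Ssym n a + ∑ i, Ssym n (Function.update a i (a i * b)) := by
  rw [Ssym_cons, ← sum_lprod_update a (· * b), Ssym, Finset.mul_sum, ← Finset.sum_add_distrib]
  refine Finset.sum_congr rfl fun τ _ => ?_
  rw [Fin.sum_univ_succ, Fin.insertNth_zero', List.ofFn_cons,
    lprod_cons _ (by simp; omega)]
  simp only [lprod_ofFn_insertNth_succ]

/-- Placing `b` either behind, or directly before, one of the factors. -/
theorem Ssym_cons_right {n : ℕ} (hn : 1 ≤ n) (b : A) (a : Fin n → A) :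
    Ssym (n + 1) (Fin.cons b a : Fin (n + 1) → A) =
      Ssym n a * b + ∑ i, Ssym n (Function.update a i (b * a i)) := by
  rw [Ssym_cons, ← sum_lprod_update a (b * ·), Ssym, Finset.sum_mul, ← Finset.sum_add_distrib]
  refine Finset.sum_congr rfl fun τ _ => ?_
  have h : List.ofFn (Fin.snoc (fun i => a (τ i)) b : Fin (n + 1) → A) =
      List.ofFn (fun i => a (τ i)) ++ [b] := by
    rw [List.ofFn_succ']
    simp [List.concat_eq_append]
  rw [Fin.sum_univ_castSucc, Fin.insertNth_last', h, lprod_append_singleton (by simp; omega),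
    add_comm]
  simp only [lprod_ofFn_insertNth_castSucc]

theorem Ssym_comp_perm {n : ℕ} (a : Fin n → A) (π : Equiv.Perm (Fin n)) :
    Ssym n (a ∘ π) = Ssym n a :=
  Equiv.sum_comp (Equiv.mulLeft π) fun σ => lprod (List.ofFn fun i => a (σ i))

theorem Ssym_eq_cons {n : ℕ} (c : Fin (n + 1) → A) (i : Fin (n + 1)) :
    ∃ a : Fin n → A, Ssym (n + 1) c = Ssym (n + 1) (Fin.cons (c i) a : Fin (n + 1) → A) := by
  refine ⟨Fin.tail (c ∘ Equiv.swap 0 i), ?_⟩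
  have h := Fin.cons_self_tail (c ∘ Equiv.swap 0 i)
  rw [Function.comp_apply, Equiv.swap_apply_left] at h
  rw [h, Ssym_comp_perm]

theorem Ssym_cons_cons_comm {n : ℕ} (x y : A) (a : Fin n → A) :
    Ssym (n + 2) (Fin.cons x (Fin.cons y a : Fin (n + 1) → A) : Fin (n + 2) → A) =
      Ssym (n + 2) (Fin.cons y (Fin.cons x a : Fin (n + 1) → A) : Fin (n + 2) → A) := by
  rw [← Ssym_comp_perm _ (Equiv.swap 0 1)]
  congr 1
  ext j
  refine Fin.cases ?_ (fun j => Fin.cases ?_ (fun j => ?_) j) j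
  · simp only [Function.comp_apply, Equiv.swap_apply_left]; rfl
  · change _ = x
    simp only [Function.comp_apply, Fin.succ_zero_eq_one, Equiv.swap_apply_right]; rfl
  · rw [Function.comp_apply, Equiv.swap_apply_of_ne_of_ne (Fin.succ_ne_zero _)
      (by simp [Fin.ext_iff])]
    rfl

theorem map_lprod {B F : Type*} [NonUnitalSemiring B] [FunLike F A B] [NonUnitalRingHomClass F A B]
    (φ : F) (l : List A) : φ (lprod l) = lprod (l.map φ) := by
  induction l with
  | nil => exact map_zero φ
  | cons a l ih =>
    cases l with
    | nil => rfl
    | cons b l =>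
      rw [lprod_cons a (by simp), map_mul, ih, List.map_cons (a := a), lprod_cons (φ a) (by simp)]

theorem map_Ssym {B F : Type*} [NonUnitalSemiring B] [FunLike F A B] [NonUnitalRingHomClass F A B]
    (φ : F) {n : ℕ} (a : Fin n → A) : φ (Ssym n a) = Ssym n (fun i => φ (a i)) := by
  simp only [Ssym, map_sum, map_lprod, List.map_ofFn]
  rfl

end Symmetrization

section Membership

variable {A : Type*} [NonUnitalRing A] {d : ℕ} (M : AddSubgroup A)

theorem Ssym_cons_mem_iff_left (hd : 1 ≤ d) (hM : ∀ a : Fin d → A, Ssym d a ∈ M) (w : A)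
    (a : Fin d → A) :
    Ssym (d + 1) (Fin.cons w a : Fin (d + 1) → A) ∈ M ↔ w * Ssym d a ∈ M := by
  rw [Ssym_cons_left hd]
  exact M.add_mem_cancel_right (M.sum_mem fun i _ => hM _)

theorem Ssym_cons_mem_iff_right (hd : 1 ≤ d) (hM : ∀ a : Fin d → A, Ssym d a ∈ M) (w : A)
    (a : Fin d → A) :
    Ssym (d + 1) (Fin.cons w a : Fin (d + 1) → A) ∈ M ↔ Ssym d a * w ∈ M := by
  rw [Ssym_cons_right hd]
  exact M.add_mem_cancel_right (M.sum_mem fun i _ => hM _)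

/-- If `M` contains all values of `S^{(d)}` and all values of `S^{(d+1)}` having `u` or `v` among
the arguments, then it contains all values of `S^{(d+1)}` having `u * v` among the arguments. -/
theorem Ssym_cons_mul_mem (hd : 1 ≤ d) (hM : ∀ a : Fin d → A, Ssym d a ∈ M) {u v : A}
    (hu : ∀ a : Fin d → A, Ssym (d + 1) (Fin.cons u a : Fin (d + 1) → A) ∈ M)
    (hv : ∀ a : Fin d → A, Ssym (d + 1) (Fin.cons v a : Fin (d + 1) → A) ∈ M) (a : Fin d → A) :
    Ssym (d + 1) (Fin.cons (u * v) a : Fin (d + 1) → A) ∈ M := by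
  obtain ⟨m, rfl⟩ : ∃ m, d = m + 1 := ⟨d - 1, by omega⟩
  have hleft := Ssym_cons_mem_iff_left M hd hM
  have hu' (c : Fin (m + 2) → A) (i : Fin (m + 2)) (hc : c i = u) : Ssym (m + 2) c ∈ M := by
    obtain ⟨e, he⟩ := Ssym_eq_cons c i
    rw [he, hc]; exact hu e
  have hv' (c : Fin (m + 2) → A) (i : Fin (m + 2)) (hc : c i = v) : Ssym (m + 2) c ∈ M := by
    obtain ⟨e, he⟩ := Ssym_eq_cons c i
    rw [he, hc]; exact hv e
  have key (w : A) (c : Fin (m + 1) → A) :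
      Ssym (m + 2) (Fin.cons w c : Fin (m + 2) → A) - w * Ssym (m + 1) c ∈ M := by
    rw [Ssym_cons_left hd, add_sub_cancel_left]
    exact M.sum_mem fun i _ => hM _
  have hvu : Ssym (m + 3) (Fin.cons v (Fin.cons u a : Fin (m + 2) → A) : Fin (m + 3) → A) -
      (Ssym (m + 2) (Fin.cons (u * v) a : Fin (m + 2) → A) +
        Ssym (m + 2) (Fin.cons (v * u) a : Fin (m + 2) → A)) ∈ M := by
    have h₁ : ∑ i : Fin (m + 1), Ssym (m + 2) (Function.update
        (Fin.cons u a : Fin (m + 2) → A) i.succ (a i * v)) ∈ M :=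
      M.sum_mem fun i _ => hu' _ 0 (by simp [(Fin.succ_ne_zero i).symm])
    have h₂ : ∑ i, v * Ssym (m + 1) (Function.update a i (a i * u)) ∈ M :=
      M.sum_mem fun i _ => (hleft _ _).1 (hv _)
    have h := M.sub_mem (M.add_mem h₁ h₂) (key (v * u) a)
    convert h using 1
    rw [Ssym_cons_left (by omega) v, Fin.sum_univ_succ, Ssym_cons_left hd u a]
    simp only [Fin.cons_zero, Fin.cons_succ, Fin.update_cons_zero, mul_add, Finset.mul_sum,
      mul_assoc]
    abel
  have hb : Ssym (m + 3) (Fin.cons v (Fin.cons u a : Fin (m + 2) → A) : Fin (m + 3) → A) -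
      Ssym (m + 2) (Fin.cons (v * u) a : Fin (m + 2) → A) ∈ M := by
    induction a using Fin.consCases with | _ b a => ?_
    have hrot : Ssym (m + 3) (Fin.cons v (Fin.cons u (Fin.cons b a : Fin (m + 1) → A) :
        Fin (m + 2) → A) : Fin (m + 3) → A) = Ssym (m + 3) (Fin.cons b (Fin.cons u
          (Fin.cons v a : Fin (m + 1) → A) : Fin (m + 2) → A) : Fin (m + 3) → A) := by
      rw [← Ssym_comp_perm (Fin.cons b _) (Equiv.swap 0 (Fin.succ (Fin.succ 0)))]
      congr 1
      ext j
      refine Fin.cases ?_ (fun j => Fin.cases ?_ (fun j => Fin.cases ?_ (fun j => ?_) j) j) j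
      · simp only [Function.comp_apply, Equiv.swap_apply_left]; rfl
      · rw [Function.comp_apply, Equiv.swap_apply_of_ne_of_ne (Fin.succ_ne_zero _)
          ((Fin.succ_injective _).ne (Fin.succ_ne_zero 0).symm)]
        rfl
      · change b = (Fin.cons b _ : Fin (m + 3) → A) (Equiv.swap 0 (Fin.succ (Fin.succ 0)) (Fin.succ (Fin.succ 0)))
        rw [Equiv.swap_apply_right]; rfl
      · rw [Function.comp_apply, Equiv.swap_apply_of_ne_of_ne (Fin.succ_ne_zero _)
          ((Fin.succ_injective _).ne ((Fin.succ_injective _).ne (Fin.succ_ne_zero j)))]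
        rfl
    have h₁ : ∑ i, Ssym (m + 2) (Function.update (Fin.cons u (Fin.cons v a : Fin (m + 1) → A) :
        Fin (m + 2) → A) i ((Fin.cons u (Fin.cons v a : Fin (m + 1) → A) :
        Fin (m + 2) → A) i * b)) ∈ M := by
      refine M.sum_mem fun i _ => ?_
      by_cases hi : i = 0
      · subst hi
        refine hv' _ 1 ?_
        rw [Function.update_of_ne (by simp)]
        rfl
      · refine hu' _ 0 ?_
        rw [Function.update_of_ne (Ne.symm hi)]
        rfl
    have h₂ : b * u * Ssym (m + 1) (Fin.cons v a : Fin (m + 1) → A) ∈ M :=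
      (hleft _ _).1 (hv' _ 1 rfl)
    have h₃ : ∑ i : Fin m, b * Ssym (m + 1) (Function.update
        (Fin.cons v a : Fin (m + 1) → A) i.succ (a i * u)) ∈ M :=
      M.sum_mem fun i _ => (hleft _ _).1 (hv' _ 1 (by
        change Function.update (Fin.cons v a : Fin (m + 1) → A) i.succ (a i * u) 0 = v
        simp [(Fin.succ_ne_zero i).symm]))
    have h := M.sub_mem (M.add_mem h₁ (M.add_mem h₂ h₃))
      (key b (Fin.cons (v * u) a : Fin (m + 1) → A))
    convert h using 1
    rw [hrot, Ssym_cons_left (by omega) b, Ssym_cons_left hd u, Fin.sum_univ_succ (n := m),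
      Ssym_cons_cons_comm b (v * u) a]
    simp only [Fin.cons_zero, Fin.cons_succ, Fin.update_cons_zero, mul_add, Finset.mul_sum,
      mul_assoc]
    abel
  have h := M.sub_mem hb hvu
  convert h using 1
  abel

end Membership

section TSpaces

variable {k : Type*} [Field k]

theorem exists_substitution (y : ℕ → FA k) : ∃ φ : FA k →ₙₐ[k] FA k, ∀ i, φ (Xg k i) = y i :=
  ⟨MonoidAlgebra.liftMagma k (FreeSemigroup.lift y), fun i => by
    simp [Xg, MonoidAlgebra.liftMagma_apply_apply]⟩

theorem subset_TSpan {S : Set (FA k)} {s : FA k} (hs : s ∈ S) : s ∈ TSpan k S :=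
  Submodule.subset_span ⟨NonUnitalAlgHom.id k (FA k), s, hs, rfl⟩

theorem isTSpace_TSpan (S : Set (FA k)) : IsTSpace k (TSpan k S) := by
  intro φ v hv
  induction hv using Submodule.span_induction with
  | mem x hx =>
    obtain ⟨ψ, s, hs, rfl⟩ := hx
    exact Submodule.subset_span ⟨φ.comp ψ, s, hs, rfl⟩
  | zero => simp
  | add x y _ _ hx hy => rw [map_add]; exact Submodule.add_mem _ hx hy
  | smul c x _ hx => rw [map_smul]; exact Submodule.smul_mem _ c hx

theorem IsTSpace.sup {V W : Submodule k (FA k)} (hV : IsTSpace k V) (hW : IsTSpace k W) :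
    IsTSpace k (V ⊔ W) := by
  intro φ x hx
  obtain ⟨v, hv, w, hw, rfl⟩ := Submodule.mem_sup.1 hx
  rw [map_add]
  exact Submodule.add_mem_sup (hV φ v hv) (hW φ w hw)

theorem TSpan_le {S : Set (FA k)} {V : Submodule k (FA k)} (hV : IsTSpace k V)
    (hS : ∀ s ∈ S, s ∈ V) : TSpan k S ≤ V := by
  refine Submodule.span_le.2 ?_
  rintro _ ⟨φ, s, hs, rfl⟩
  exact hV φ s (hS s hs)

theorem Sn_one (d : ℕ) : Sn k d 1 = TSpan k {Ssym d (fun i => Xg k i)} := by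
  rw [Sn]

theorem isTSpace_Sn_one (d : ℕ) : IsTSpace k (Sn k d 1) := by
  rw [Sn_one]
  exact isTSpace_TSpan _

theorem Ssym_mem_Sn_one (d : ℕ) (a : Fin d → FA k) : Ssym d a ∈ Sn k d 1 := by
  obtain ⟨φ, hφ⟩ := exists_substitution (k := k) fun i => if h : i < d then a ⟨i, h⟩ else 0
  have h : φ (Ssym d fun i => Xg k i) = Ssym d a := by
    rw [map_Ssym]
    congr 1
    ext1 i
    rw [hφ, dif_pos i.2]
  rw [← h]
  refine isTSpace_Sn_one d φ _ ?_
  rw [Sn_one]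
  exact subset_TSpan rfl

theorem Sn_one_le {d : ℕ} {V : Submodule k (FA k)} (h : ∀ a : Fin d → FA k, Ssym d a ∈ V) :
    Sn k d 1 ≤ V := by
  rw [Sn_one]
  refine Submodule.span_le.2 ?_
  rintro _ ⟨φ, _, rfl, rfl⟩
  rw [map_Ssym]
  exact h _

theorem Sn_one_mul_mul_mem {d : ℕ} (hd : 1 ≤ d) {M : Submodule k (FA k)} {u v : FA k}
    (hM : Sn k d 1 ≤ M) (hu : ∀ f ∈ Sn k d 1, f * u ∈ M) (hv : ∀ f ∈ Sn k d 1, f * v ∈ M)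
    {f : FA k} (hf : f ∈ Sn k d 1) : f * u * v ∈ M := by
  have hS (a : Fin d → FA k) : Ssym d a ∈ M.toAddSubgroup := hM (Ssym_mem_Sn_one d a)
  have hiff := Ssym_cons_mem_iff_right M.toAddSubgroup hd hS
  suffices Sn k d 1 ≤ M.comap (LinearMap.mulRight k (u * v)) by
    rw [mul_assoc]
    exact this hf
  refine Sn_one_le fun a => (hiff _ a).1 ?_
  exact Ssym_cons_mul_mem _ hd hS (fun c => (hiff _ c).2 (hu _ (Ssym_mem_Sn_one d c)))
    (fun c => (hiff _ c).2 (hv _ (Ssym_mem_Sn_one d c))) a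

theorem mul_mul_Sn_one_mem {d : ℕ} (hd : 1 ≤ d) {M : Submodule k (FA k)} {u v : FA k}
    (hM : Sn k d 1 ≤ M) (hu : ∀ f ∈ Sn k d 1, u * f ∈ M) (hv : ∀ f ∈ Sn k d 1, v * f ∈ M)
    {f : FA k} (hf : f ∈ Sn k d 1) : u * v * f ∈ M := by
  have hS (a : Fin d → FA k) : Ssym d a ∈ M.toAddSubgroup := hM (Ssym_mem_Sn_one d a)
  have hiff := Ssym_cons_mem_iff_left M.toAddSubgroup hd hS
  suffices Sn k d 1 ≤ M.comap (LinearMap.mulLeft k (u * v)) from this hf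
  refine Sn_one_le fun a => (hiff _ a).1 ?_
  exact Ssym_cons_mul_mem _ hd hS (fun c => (hiff _ c).2 (hu _ (Ssym_mem_Sn_one d c)))
    (fun c => (hiff _ c).2 (hv _ (Ssym_mem_Sn_one d c))) a

end TSpaces

/-- For any `u, v`: `(S_1^{(d)} u v)^S ⊆ S_1^{(d)} + (S_1^{(d)} u)^S + (S_1^{(d)} v)^S`
and `(u v S_1^{(d)})^S ⊆ S_1^{(d)} + (u S_1^{(d)})^S + (v S_1^{(d)})^S`. -/
theorem generalized_r2_eq_r3 (k : Type*) [Field k] (d : ℕ) (hd : 1 ≤ d)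
    (u v : FA k) :
    TSpan k {a | ∃ f ∈ Sn k d 1, a = f * u * v} ≤
      Sn k d 1 ⊔ TSpan k {a | ∃ f ∈ Sn k d 1, a = f * u}
        ⊔ TSpan k {a | ∃ f ∈ Sn k d 1, a = f * v} ∧
    TSpan k {a | ∃ f ∈ Sn k d 1, a = u * v * f} ≤
      Sn k d 1 ⊔ TSpan k {a | ∃ f ∈ Sn k d 1, a = u * f}
        ⊔ TSpan k {a | ∃ f ∈ Sn k d 1, a = v * f} := by
  constructor
  · refine TSpan_le (((isTSpace_Sn_one d).sup (isTSpace_TSpan _)).sup (isTSpace_TSpan _)) ?_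
    rintro _ ⟨f, hf, rfl⟩
    refine Sn_one_mul_mul_mem hd (le_sup_left.trans le_sup_left) (fun g hg => ?_)
      (fun g hg => ?_) hf
    · exact Submodule.mem_sup_left (Submodule.mem_sup_right (subset_TSpan ⟨g, hg, rfl⟩))
    · exact Submodule.mem_sup_right (subset_TSpan ⟨g, hg, rfl⟩)
  · refine TSpan_le (((isTSpace_Sn_one d).sup (isTSpace_TSpan _)).sup (isTSpace_TSpan _)) ?_
    rintro _ ⟨f, hf, rfl⟩
    refine mul_mul_Sn_one_mem hd (le_sup_left.trans le_sup_left) (fun g hg => ?_)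
      (fun g hg => ?_) hf
    · exact Submodule.mem_sup_left (Submodule.mem_sup_right (subset_TSpan ⟨g, hg, rfl⟩))
    · exact Submodule.mem_sup_right (subset_TSpan ⟨g, hg, rfl⟩)
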